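/- arXiv:2211.03244 — 2 statements merged into one kernel-verified Lean document; each statement's English description precedes it below -/
import Mathlib

section
/- Theorem 3 part (ii) (necessary condition for no-arbitrage): suppose for every agent i ∈ I there are a strategy a_i ∈ A_i and a set T_i ⊆ ∏_{j≠i} A_j (the set A_{-i}(m̃, a_i) backed out from the observed market SDF) such that a_i is NOT dominated relative to T_i (no agent has a tradeable arbitrage opportunity). Then every agent i either has a_i ∈ ⋂_{n≥0} UD_i^n, or there exists an order k_i ≥ 1 with a_i ∈ UD_i^{k_i} \ UD_i^{k_i+1} and T_i not contained in ∏_{j≠i} UD_j^{k_i}. -/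
open MeasureTheory
open scoped Classical

namespace ArbitrageBeliefs

variable {I : Type*} {A : I → Type*} {S : Type*}

/-- Splice agent `i`'s strategy `ai` together with a profile `b` of the other
agents' strategies into a full strategy profile. -/
noncomputable def splice (i : I) (ai : A i)
    (b : ∀ j : {j : I // j ≠ i}, A j.1) : ∀ j, A j := fun j =>
  if h : j = i then h.symm ▸ ai else b ⟨j, h⟩

/-- Agent `i`'s strategy `ai` is dominated relative to a set `T` of profiles of
the other agents' strategies: against every profile in `T` there is an
alternative strategy that gives `P`-a.s. weakly higher utility and strictly
higher utility with positive probability. -/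
def Dominated [MeasurableSpace S] (P : Measure S)
    (Ui : (∀ j, A j) → S → ℝ) (i : I) (ai : A i)
    (T : Set (∀ j : {j : I // j ≠ i}, A j.1)) : Prop :=
  ∀ b ∈ T, ∃ ai' : A i,
    (∀ᵐ s ∂P, Ui (splice i ai b) s ≤ Ui (splice i ai' b) s) ∧
    0 < P {s | Ui (splice i ai b) s < Ui (splice i ai' b) s}

/-- The undominated response sets, defined by simultaneous recursion:
`UD P U 0 i = A i` and
`UD P U (k+1) i = {ai ∈ UD P U k i : ai not dominated rel. ∏_{j ≠ i} UD P U k j}`. -/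
def UD [MeasurableSpace S] (P : Measure S)
    (U : ∀ i : I, (∀ j, A j) → S → ℝ) : ℕ → ∀ i, Set (A i)
  | 0 => fun _ => Set.univ
  | (k + 1) => fun i =>
      {ai | ai ∈ UD P U k i ∧
        ¬ Dominated P (U i) i ai {b | ∀ j, b j ∈ UD P U k j.1}}

/-- The product set `∏_{j ≠ i} UD_j^k` of the other agents' undominated
`k`-th order responses. -/
def PiUD [MeasurableSpace S] (P : Measure S)
    (U : ∀ i : I, (∀ j, A j) → S → ℝ) (k : ℕ) (i : I) :
    Set (∀ j : {j : I // j ≠ i}, A j.1) :=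
  {b | ∀ j, b j ∈ UD P U k j.1}

theorem Dominated.mono [MeasurableSpace S] {P : Measure S}
    {Ui : (∀ j, A j) → S → ℝ} {i : I} {ai : A i}
    {T T' : Set (∀ j : {j : I // j ≠ i}, A j.1)}
    (h : Dominated P Ui i ai T') (hT : T ⊆ T') : Dominated P Ui i ai T :=
  fun b hb => h b (hT hb)

/-- Theorem 3(ii), necessity for no-arbitrage: if no agent's strategy
is dominated relative to her backed-out set `T i`, then every agent either chooses
in `⋂_n UD_i^n`, or chooses in `UD_i^{k} \\ UD_i^{k+1}` for some `k ≥ 1` with `T i`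
not contained in `∏_{j≠i} UD_j^k`. -/
theorem no_arbitrage_necessary [Fintype I] [∀ i, Nonempty (A i)]
    [MeasurableSpace S] (P : Measure S) [IsProbabilityMeasure P]
    (U : ∀ i : I, (∀ j, A j) → S → ℝ)
    (hU : ∀ (i : I) (a : ∀ j, A j), Measurable (U i a))
    (a : ∀ i, A i)
    (T : ∀ i : I, Set (∀ j : {j : I // j ≠ i}, A j.1))
    (hnoarb : ∀ i, ¬ Dominated P (U i) i (a i) (T i)) :
    ∀ i, (a i ∈ ⋂ n : ℕ, UD P U n i) ∨
      ∃ k : ℕ, 1 ≤ k ∧ a i ∈ UD P U k i \ UD P U (k + 1) i ∧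
        ¬ T i ⊆ PiUD P U k i := by
  intro i
  by_cases h : ∃ n, a i ∉ UD P U n i
  · right
    obtain ⟨k, hk, hk'⟩ : ∃ k, a i ∈ UD P U k i ∧ a i ∉ UD P U (k + 1) i := by
      by_contra! hstep
      obtain ⟨n, hn⟩ := h
      exact hn (Nat.rec (Set.mem_univ _) hstep n)
    have hT : ¬ T i ⊆ PiUD P U k i := fun hsub =>
      hk' ⟨hk, fun hdom => hnoarb i (hdom.mono hsub)⟩
    refine ⟨k, Nat.one_le_iff_ne_zero.mpr ?_, ⟨hk, hk'⟩, hT⟩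
    rintro rfl
    exact hT fun _ _ _ => Set.mem_univ _
  · left
    push Not at h
    exact Set.mem_iInter.mpr h

end ArbitrageBeliefs
end

section
/- Proposition 6 (tatonnement adjustment corresponds to belief-hierarchy revision): fix an agent i, an order k ≥ 1, and a set T ⊆ ∏_{j≠i} A_j (the set A_{-i}(m̃, a_i) backed out from the observed market SDF). Suppose initially agent i holds a strategy a_i ∈ UD_i^k (the response of a belief hierarchy of order k) that is dominated relative to T (a dominated-wrtp response), and subsequently she switches to a strategy a*_i ∈ A_i that is not dominated relative to T (an undominated-wrtp response). Then: (1) T does not contain ∏_{j≠i} UD_j^{k-1}; and (2) either a*_i ∈ ⋂_{n≥0} UD_i^n, or there exists an order k' ≥ 1 with a*_i ∈ UD_i^{k'} \ UD_i^{k'+1} and T not contained in ∏_{j≠i} UD_j^{k'}. -/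
open MeasureTheory
open scoped Classical

namespace ArbitrageBeliefs

variable {I : Type*} {A : I → Type*} {S : Type*}

theorem mem_UD_succ [MeasurableSpace S] {P : Measure S}
    {U : ∀ i : I, (∀ j, A j) → S → ℝ} {k : ℕ} {i : I} {ai : A i} :
    ai ∈ UD P U (k + 1) i ↔ ai ∈ UD P U k i ∧ ¬ Dominated P (U i) i ai (PiUD P U k i) :=
  Iff.rfl

/-- Proposition 6: if agent `i` initially holds `a_i ∈ UD_i^k`
(`k ≥ 1`) that is dominated relative to the backed-out set `T`, and subsequently
switches to `a*_i` undominated relative to `T`, then (1) `T` does not contain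
`∏_{j≠i} UD_j^{k-1}`, and (2) either `a*_i ∈ ⋂_n UD_i^n` or there is `k' ≥ 1` with
`a*_i ∈ UD_i^{k'} \\ UD_i^{k'+1}` and `T` not contained in `∏_{j≠i} UD_j^{k'}`. -/
theorem tatonnement_belief_revision [Fintype I] [∀ i, Nonempty (A i)]
    [MeasurableSpace S] (P : Measure S) [IsProbabilityMeasure P]
    (U : ∀ i : I, (∀ j, A j) → S → ℝ)
    (hU : ∀ (i : I) (a : ∀ j, A j), Measurable (U i a))
    (i : I) (k : ℕ) (hk : 1 ≤ k)
    (T : Set (∀ j : {j : I // j ≠ i}, A j.1))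
    (ai astar : A i)
    (hai : ai ∈ UD P U k i)
    (hdom : Dominated P (U i) i ai T)
    (hundom : ¬ Dominated P (U i) i astar T) :
    (¬ PiUD P U (k - 1) i ⊆ T) ∧
      ((astar ∈ ⋂ n : ℕ, UD P U n i) ∨
        ∃ k' : ℕ, 1 ≤ k' ∧ astar ∈ UD P U k' i \ UD P U (k' + 1) i ∧
          ¬ T ⊆ PiUD P U k' i) := by
  obtain ⟨m, rfl⟩ := Nat.exists_eq_add_of_le' hk
  refine ⟨fun h => (mem_UD_succ.1 hai).2 (hdom.mono h), or_iff_not_imp_left.2 fun hinter => ?_⟩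
  have hsucc : ∀ n, astar ∈ UD P U n i → T ⊆ PiUD P U n i → astar ∈ UD P U (n + 1) i :=
    fun n hn hT => mem_UD_succ.2 ⟨hn, fun h => hundom (h.mono hT)⟩
  have hone : astar ∈ UD P U 1 i := hsucc 0 (Set.mem_univ _) fun _ _ _ => Set.mem_univ _
  by_contra! hnone
  have hpos : ∀ n, 1 ≤ n → astar ∈ UD P U n i := by
    intro n hn
    induction n, hn using Nat.le_induction with
    | base => exact hone
    | succ n hn ih =>
      by_contra hnot
      exact hnot (hsucc n ih (hnone n hn ⟨ih, hnot⟩))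
  refine hinter (Set.mem_iInter.2 fun n => ?_)
  cases n with
  | zero => exact Set.mem_univ _
  | succ n => exact hpos (n + 1) n.succ_pos


end ArbitrageBeliefs
end
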